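/- Let r, q ∈ ℝ, σ > 0, c > 0, K > 0, γ > 0 and T ∈ ℝ. Define for X > 0 and t ≤ T: V(X,t) = c X^γ e^{μ(γ)(T−t)} N(d₁) − K e^{−r(T−t)} N(d₂), where d₂ = [ (1/γ)·ln(c X^γ / K) + (r − q − σ²/2)(T−t) ] / (σ√(T−t)) and d₁ = d₂ + γσ√(T−t). Then for all X > 0 and t < T, ∂V/∂t + (σ²/2)X² ∂²V/∂X² + (r−q)X ∂V/∂X − rV = 0, and lim_{t → T⁻} V(X,t) = max(c X^γ − K, 0) for every X > 0. -/

import Mathlib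

open MeasureTheory Filter Topology

/-- `μ(γ) = (γ−1)r − γq + (σ²/2)(γ²−γ)` -/
noncomputable def mu (r q σ γ : ℝ) : ℝ := (γ - 1) * r - γ * q + σ ^ 2 / 2 * (γ ^ 2 - γ)

/-- The standard normal cumulative distribution function. -/
noncomputable def normCDF (d : ℝ) : ℝ :=
  (Real.sqrt (2 * Real.pi))⁻¹ * ∫ y in Set.Iio d, Real.exp (-y ^ 2 / 2)

/-- The quantity `d₂` in the price of the power call option with payoff `(c X^γ − K)⁺`. -/
noncomputable def d₂ (r q σ c K γ T : ℝ) (X t : ℝ) : ℝ :=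
  ((1 / γ) * Real.log (c * X ^ γ / K) + (r - q - σ ^ 2 / 2) * (T - t)) /
    (σ * Real.sqrt (T - t))

lemma integrable_exp_neg_sq_div_two :
    Integrable (fun y : ℝ => Real.exp (-y ^ 2 / 2)) := by
  refine (integrable_exp_neg_mul_sq (b := 1 / 2) (by norm_num)).congr (.of_forall fun y => congrArg Real.exp ?_)
  ring

lemma integral_exp_neg_sq_div_two :
    ∫ y : ℝ, Real.exp (-y ^ 2 / 2) = Real.sqrt (2 * Real.pi) := by
  rw [show 2 * Real.pi = Real.pi / (1 / 2) by ring, ← integral_gaussian]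
  congr! 3
  ring

/-- The standard normal density. -/
noncomputable def normPDF (d : ℝ) : ℝ := (Real.sqrt (2 * Real.pi))⁻¹ * Real.exp (-d ^ 2 / 2)

lemma hasDerivAt_normCDF (d : ℝ) : HasDerivAt normCDF (normPDF d) d := by
  have hint := integrable_exp_neg_sq_div_two
  have hcont : Continuous fun y : ℝ => Real.exp (-y ^ 2 / 2) := by fun_prop
  have hsplit : normCDF = fun x => (Real.sqrt (2 * Real.pi))⁻¹ *
      ((∫ y in Set.Iic 0, Real.exp (-y ^ 2 / 2)) + ∫ y in (0 : ℝ)..x, Real.exp (-y ^ 2 / 2)) := by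
    funext x
    rw [normCDF, ← integral_Iic_eq_integral_Iio,
      ← intervalIntegral.integral_Iic_sub_Iic hint.integrableOn hint.integrableOn]
    ring
  rw [hsplit]
  exact ((intervalIntegral.integral_hasDerivAt_right (hcont.intervalIntegrable _ _)
    (hcont.stronglyMeasurableAtFilter _ _) hcont.continuousAt).const_add _).const_mul _

lemma tendsto_normCDF_atBot : Tendsto normCDF atBot (𝓝 0) := by
  have h := (tendsto_integral_Iio_zero (f := fun y : ℝ => Real.exp (-y ^ 2 / 2)) (μ := volume)
    tendsto_id).const_mul (Real.sqrt (2 * Real.pi))⁻¹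
  rwa [mul_zero] at h

lemma tendsto_normCDF_atTop : Tendsto normCDF atTop (𝓝 1) := by
  have hcover := aecover_Iio (μ := volume) (tendsto_id (α := ℝ))
  have h := (hcover.integral_tendsto_of_countably_generated
    integrable_exp_neg_sq_div_two).const_mul (Real.sqrt (2 * Real.pi))⁻¹
  rw [integral_exp_neg_sq_div_two, inv_mul_cancel₀ (by positivity)] at h
  exact h

lemma d₂_mul (r q σ c K γ T : ℝ) {X t : ℝ} (hσ : 0 < σ) (ht : t < T) :
    d₂ r q σ c K γ T X t * (σ * Real.sqrt (T - t)) =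
      1 / γ * Real.log (c * X ^ γ / K) + (r - q - σ ^ 2 / 2) * (T - t) := by
  have : 0 < Real.sqrt (T - t) := Real.sqrt_pos.2 (sub_pos.2 ht)
  rw [d₂, div_mul_cancel₀ _ (by positivity)]

/-- The two density terms appearing when the price is differentiated through `d₁` and `d₂`
coincide. -/
lemma asset_mul_normPDF_eq (r q σ c K γ T : ℝ) {X t : ℝ} (hσ : 0 < σ) (hc : 0 < c) (hK : 0 < K)
    (hγ : 0 < γ) (hX : 0 < X) (ht : t < T) :
    c * X ^ γ * Real.exp (mu r q σ γ * (T - t)) *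
        normPDF (d₂ r q σ c K γ T X t + γ * σ * Real.sqrt (T - t)) =
      K * Real.exp (-(r * (T - t))) * normPDF (d₂ r q σ c K γ T X t) := by
  have hlog : c * X ^ γ = K * Real.exp (Real.log (c * X ^ γ / K)) := by
    rw [Real.exp_log (by positivity)]
    field_simp
  have hd := d₂_mul r q σ c K γ T (X := X) hσ ht
  have hsq : Real.sqrt (T - t) ^ 2 = T - t := Real.sq_sqrt (sub_pos.2 ht).le
  set L := Real.log (c * X ^ γ / K)
  set d := d₂ r q σ c K γ T X t
  set s := Real.sqrt (T - t)
  have hd' : γ * (d * (σ * s)) = L + γ * ((r - q - σ ^ 2 / 2) * (T - t)) := by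
    rw [hd]
    field_simp
  have hexp : L + mu r q σ γ * (T - t) + -(d + γ * σ * s) ^ 2 / 2 =
      -(r * (T - t)) + -d ^ 2 / 2 := by
    rw [mu]
    linear_combination -hd' - γ ^ 2 * σ ^ 2 / 2 * hsq
  have key := congrArg Real.exp hexp
  simp only [Real.exp_add] at key
  rw [hlog, normPDF, normPDF]
  linear_combination K * (Real.sqrt (2 * Real.pi))⁻¹ * key

lemma hasDerivAt_d₂_asset (r q σ c K γ T : ℝ) {X t : ℝ} (hc : 0 < c) (hK : 0 < K)
    (hγ : 0 < γ) (hX : 0 < X) :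
    HasDerivAt (fun y => d₂ r q σ c K γ T y t) (1 / (X * (σ * Real.sqrt (T - t)))) X := by
  have hlog := (((Real.hasDerivAt_rpow_const (p := γ) (Or.inl hX.ne')).const_mul c).div_const
    K).log (by positivity)
  have h := ((hlog.const_mul (1 / γ)).add_const
    ((r - q - σ ^ 2 / 2) * (T - t))).div_const (σ * Real.sqrt (T - t))
  refine h.congr_deriv ?_
  rw [Real.rpow_sub_one hX.ne']
  have : 0 < X ^ γ := by positivity
  field_simp

lemma differentiableAt_d₂_time (r q σ c K γ T X : ℝ) {t : ℝ} (hσ : 0 < σ) (ht : t < T) :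
    DifferentiableAt ℝ (fun u => d₂ r q σ c K γ T X u) t := by
  have hτ : T - t ≠ 0 := (sub_pos.2 ht).ne'
  have hs : σ * Real.sqrt (T - t) ≠ 0 := by
    have := Real.sqrt_pos.2 (sub_pos.2 ht)
    positivity
  unfold d₂
  fun_prop (disch := assumption)

lemma tendsto_sqrt_sub_nhdsLT (T : ℝ) :
    Tendsto (fun t => Real.sqrt (T - t)) (𝓝[<] T) (𝓝[>] 0) := by
  refine tendsto_nhdsWithin_iff.2 ⟨?_, ?_⟩
  · have : Continuous fun t => Real.sqrt (T - t) := by fun_prop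
    simpa using (this.tendsto T).mono_left nhdsWithin_le_nhds
  · filter_upwards [self_mem_nhdsWithin] with t ht
    exact Real.sqrt_pos.2 (sub_pos.2 ht)

/-- Near maturity, `d₂` plus a multiple of `√(T - t)` is a multiple of `1 / √(T - t)` up to a
vanishing term. -/
lemma d₂_add_mul_sqrt_eventuallyEq (r q σ c K γ T X b : ℝ) (hσ : 0 < σ) :
    (fun t => Real.log (c * X ^ γ / K) / (γ * σ) * (Real.sqrt (T - t))⁻¹ +
      ((r - q - σ ^ 2 / 2) / σ + b) * Real.sqrt (T - t)) =ᶠ[𝓝[<] T]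
    fun t => d₂ r q σ c K γ T X t + b * Real.sqrt (T - t) := by
  filter_upwards [self_mem_nhdsWithin] with t ht
  have hs : 0 < Real.sqrt (T - t) := Real.sqrt_pos.2 (sub_pos.2 ht)
  have hsq : Real.sqrt (T - t) ^ 2 = T - t := Real.sq_sqrt (sub_pos.2 ht).le
  rw [d₂, ← hsq, Real.sqrt_sq hs.le]
  field_simp
  ring

lemma tendsto_normCDF_d₂_add (r q σ c K γ T X b : ℝ) (hσ : 0 < σ) (hγ : 0 < γ) :
    (0 < Real.log (c * X ^ γ / K) → Tendsto
      (fun t => normCDF (d₂ r q σ c K γ T X t + b * Real.sqrt (T - t))) (𝓝[<] T) (𝓝 1)) ∧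
    (Real.log (c * X ^ γ / K) < 0 → Tendsto
      (fun t => normCDF (d₂ r q σ c K γ T X t + b * Real.sqrt (T - t))) (𝓝[<] T) (𝓝 0)) ∧
    (Real.log (c * X ^ γ / K) = 0 → Tendsto
      (fun t => normCDF (d₂ r q σ c K γ T X t + b * Real.sqrt (T - t))) (𝓝[<] T)
        (𝓝 (normCDF 0))) := by
  have hs := tendsto_sqrt_sub_nhdsLT T
  have hinv := tendsto_inv_nhdsGT_zero.comp hs
  have hlin := (hs.mono_right nhdsWithin_le_nhds).const_mul ((r - q - σ ^ 2 / 2) / σ + b)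
  have heq := d₂_add_mul_sqrt_eventuallyEq r q σ c K γ T X b hσ
  refine ⟨fun hL => ?_, fun hL => ?_, fun hL => ?_⟩
  · exact tendsto_normCDF_atTop.comp
      (((hinv.const_mul_atTop (by positivity)).atTop_add hlin).congr' heq)
  · exact tendsto_normCDF_atBot.comp
      (((hinv.const_mul_atTop_of_neg (div_neg_of_neg_of_pos hL (by positivity))).atBot_add
        hlin).congr' heq)
  · simp only [hL, zero_div, zero_mul, zero_add, mul_zero] at heq hlin
    exact (hasDerivAt_normCDF 0).continuousAt.tendsto.comp (hlin.congr' heq)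

/-- **First induction step of Theorem 5.** The Black–Scholes price of the call-type option
whose terminal payoff is `(c X^γ − K)⁺`:
`V(X,t) = c X^γ e^{μ(γ)(T−t)} N(d₁) − K e^{−r(T−t)} N(d₂)` with
`d₁ = d₂ + γσ√(T−t)` solves the Black–Scholes equation and attains the payoff as `t → T⁻`. -/
theorem power_call_option_price (r q σ c K γ T : ℝ)
    (hσ : 0 < σ) (hc : 0 < c) (hK : 0 < K) (hγ : 0 < γ)
    (V : ℝ → ℝ → ℝ)
    (hV : ∀ X t : ℝ, 0 < X → t < T →
      V X t = c * X ^ γ * Real.exp (mu r q σ γ * (T - t)) *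
          normCDF (d₂ r q σ c K γ T X t + γ * σ * Real.sqrt (T - t))
        - K * Real.exp (-(r * (T - t))) * normCDF (d₂ r q σ c K γ T X t)) :
    (∀ X t : ℝ, 0 < X → t < T →
      deriv (fun u => V X u) t
        + σ ^ 2 / 2 * X ^ 2 * deriv (fun y => deriv (fun z => V z t) y) X
        + (r - q) * X * deriv (fun y => V y t) X
        - r * V X t = 0) ∧
    (∀ X : ℝ, 0 < X →
      Tendsto (fun t => V X t) (𝓝[<] T) (𝓝 (max (c * X ^ γ - K) 0))) := by
  refine ⟨fun X t hX ht => ?_, fun X hX => ?_⟩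
  · have hτ : 0 < T - t := sub_pos.2 ht
    have hs : 0 < Real.sqrt (T - t) := Real.sqrt_pos.2 hτ
    have hN1 : ∀ y, 0 < y → HasDerivAt
        (fun z => normCDF (d₂ r q σ c K γ T z t + γ * σ * Real.sqrt (T - t)))
        (normPDF (d₂ r q σ c K γ T y t + γ * σ * Real.sqrt (T - t)) *
          (1 / (y * (σ * Real.sqrt (T - t))))) y := fun y hy =>
      (hasDerivAt_normCDF _).comp y ((hasDerivAt_d₂_asset r q σ c K γ T hc hK hγ hy).add_const _)
    have hVX : ∀ y, 0 < y → deriv (fun z => V z t) y =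
        c * (γ * y ^ (γ - 1)) * Real.exp (mu r q σ γ * (T - t)) *
          normCDF (d₂ r q σ c K γ T y t + γ * σ * Real.sqrt (T - t)) := by
      intro y hy
      have heq : (fun z => V z t) =ᶠ[𝓝 y] _ :=
        (eventually_gt_nhds hy).mono fun z hz => hV z t hz ht
      have hN2 := (hasDerivAt_normCDF _).comp y
        (hasDerivAt_d₂_asset r q σ c K γ T (t := t) hc hK hγ hy)
      rw [heq.deriv_eq]
      refine ((((((Real.hasDerivAt_rpow_const (p := γ) (Or.inl hy.ne')).const_mul c).mul_const
        (Real.exp (mu r q σ γ * (T - t)))).mul (hN1 y hy)).sub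
        (hN2.const_mul (K * Real.exp (-(r * (T - t)))))).congr_deriv ?_).deriv
      linear_combination (1 / (y * (σ * Real.sqrt (T - t)))) *
        asset_mul_normPDF_eq r q σ c K γ T hσ hc hK hγ hy ht
    have hVXX := (((((Real.hasDerivAt_rpow_const (p := γ - 1) (Or.inl hX.ne')).const_mul
      γ).const_mul c).mul_const (Real.exp (mu r q σ γ * (T - t)))).mul (hN1 X hX)).deriv
    have heqX : (fun y => deriv (fun z => V z t) y) =ᶠ[𝓝 X] _ :=
      (eventually_gt_nhds hX).mono fun y hy => hVX y hy
    have heqt : (fun u => V X u) =ᶠ[𝓝 t] _ :=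
      (eventually_lt_nhds ht).mono fun u hu => hV X u hX hu
    have hd := (differentiableAt_d₂_time r q σ c K γ T X hσ ht).hasDerivAt
    have hsub := (hasDerivAt_id t).const_sub T
    have hVt := (((((hsub.const_mul (mu r q σ γ)).exp).const_mul (c * X ^ γ)).mul
      ((hasDerivAt_normCDF _).comp t (hd.add ((hsub.sqrt hτ.ne').const_mul (γ * σ))))).sub
      ((((hsub.const_mul r).neg.exp).const_mul K).mul ((hasDerivAt_normCDF _).comp t hd))).deriv
    have hkey := asset_mul_normPDF_eq r q σ c K γ T hσ hc hK hγ hX ht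
    rw [heqX.deriv_eq, heqt.deriv_eq, hVX X hX, hV X t hX ht]
    erw [hVXX, hVt]
    simp only [Function.comp, id, Pi.add_apply, Pi.neg_apply]
    rw [Real.rpow_sub_one hX.ne', Real.rpow_sub_one hX.ne']
    generalize Real.exp (mu r q σ γ * (T - t)) = E at hkey ⊢
    generalize Real.exp (-(r * (T - t))) = F at hkey ⊢
    generalize normPDF (d₂ r q σ c K γ T X t + γ * σ * Real.sqrt (T - t)) = φ₁ at hkey ⊢
    generalize normCDF (d₂ r q σ c K γ T X t + γ * σ * Real.sqrt (T - t)) = N₁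
    rw [mu]
    field_simp
    linear_combination 2 * Real.sqrt (T - t) * deriv (fun u => d₂ r q σ c K γ T X u) t * hkey
  · have h1 := tendsto_normCDF_d₂_add r q σ c K γ T X (γ * σ) hσ hγ
    have h2 := tendsto_normCDF_d₂_add r q σ c K γ T X 0 hσ hγ
    simp only [zero_mul, add_zero] at h2
    have hA : Tendsto (fun t => c * X ^ γ * Real.exp (mu r q σ γ * (T - t))) (𝓝[<] T)
        (𝓝 (c * X ^ γ)) := by
      have : Continuous fun t => c * X ^ γ * Real.exp (mu r q σ γ * (T - t)) := by fun_prop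
      simpa using (this.tendsto T).mono_left nhdsWithin_le_nhds
    have hB : Tendsto (fun t => K * Real.exp (-(r * (T - t)))) (𝓝[<] T) (𝓝 K) := by
      have : Continuous fun t => K * Real.exp (-(r * (T - t))) := by fun_prop
      simpa using (this.tendsto T).mono_left nhdsWithin_le_nhds
    have hpos : 0 < c * X ^ γ / K := by positivity
    have heq : (fun t => V X t) =ᶠ[𝓝[<] T] _ :=
      eventually_nhdsWithin_of_forall fun t ht => hV X t hX ht
    refine Tendsto.congr' heq.symm ?_
    rcases lt_trichotomy (Real.log (c * X ^ γ / K)) 0 with hL | hL | hL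
    · have hlt : c * X ^ γ < K := (div_lt_one hK).1 ((Real.log_neg_iff hpos).1 hL)
      rw [max_eq_right (by linarith)]
      simpa using (hA.mul (h1.2.1 hL)).sub (hB.mul (h2.2.1 hL))
    · have hEq : c * X ^ γ = K :=
        (div_eq_one_iff_eq hK.ne').1 (Real.eq_one_of_pos_of_log_eq_zero hpos hL)
      simpa [hEq] using (hA.mul (h1.2.2 hL)).sub (hB.mul (h2.2.2 hL))
    · have hlt : K < c * X ^ γ := (one_lt_div hK).1 ((Real.log_pos_iff hpos.le).1 hL)
      rw [max_eq_left (by linarith)]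
      simpa using (hA.mul (h1.1 hL)).sub (hB.mul (h2.1 hL))
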